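/- For every integer t ≥ 3 there exists a constant C(t) ∈ (0,∞) such that the following holds. Let n ≥ 2 and k ≥ 1 be integers, let A₁,…,A_k ∈ Π_n^{(t)}, let d = (d₁,…,d_t) ∈ [n]^t, and let Λ_d = { (A₁(x),…,A_k(x)) : x = (x₁,…,x_t) with x_s ∈ C_{d_s}^n for each s ∈ [t] } ⊆ ℝ^k. Then for every real ε ≥ 1 there exists a set N ⊆ Λ_d with |N| ≤ n^{2t·max(d)/ε^{2/t}} such that every point of Λ_d is within Euclidean distance C(t)·ε·√(k·min(d)) of some point of N. -/

import Mathlib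

/-- Evaluation of a `t`-linear form on `ℝ^n`, given by its coefficient tensor `A`. -/
noncomputable def evalForm {t n : ℕ} (A : (Fin t → Fin n) → ℝ) (x : Fin t → Fin n → ℝ) : ℝ :=
  ∑ z : Fin t → Fin n, A z * ∏ j, x j (z j)

/-- Plane sub-stochastic `t`-linear forms on `ℝ^n`. -/
def PlaneSubStochastic {t n : ℕ} (A : (Fin t → Fin n) → ℝ) : Prop :=
  (∀ s, 0 ≤ A s) ∧
  ∀ (j : Fin t) (i : Fin n), (∑ s : Fin t → Fin n, if s j = i then A s else 0) ≤ 1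

/-- `Π_n^{(t)}`: forms `A` with `|A|` plane sub-stochastic. -/
def PiSet (t n : ℕ) : Set ((Fin t → Fin n) → ℝ) :=
  {A | PlaneSubStochastic fun s => |A s|}

/-- `C_d^n`: the set of `{−1,0,1}`-vectors in `ℝ^n` with exactly `min{d,n}` nonzero
coordinates. -/
def Cball (n d : ℕ) : Set (Fin n → ℝ) :=
  {x | (∀ i, x i = -1 ∨ x i = 0 ∨ x i = 1) ∧ {i | x i ≠ 0}.ncard = min d n}

/-- `Λ_d = {(A₁(x),…,A_k(x)) : x_s ∈ C_{d_s}^n} ⊆ ℝ^k`. -/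
def Lambda (t n k : ℕ) (A : Fin k → ((Fin t → Fin n) → ℝ)) (d : Fin t → ℕ) :
    Set (Fin k → ℝ) :=
  {l | ∃ x : Fin t → Fin n → ℝ, (∀ s, x s ∈ Cball n (d s)) ∧
    l = fun i => evalForm (A i) x}

open Finset in
/-- The law of a random subset containing each element independently with probability `p`. -/
theorem exists_bernoulli_weights {ι : Type*} [Fintype ι] [DecidableEq ι] {p : ℝ}
    (hp0 : 0 ≤ p) (hp1 : p ≤ 1) :
    ∃ w : Finset ι → ℝ, (∀ S, 0 ≤ w S) ∧
      ∀ T : Finset ι, ∑ S, w S * (if T ⊆ S then 1 else 0) = p ^ #T := by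
  refine ⟨fun S => (∏ _i ∈ S, p) * ∏ _i ∈ univ \ S, (1 - p), fun S => ?_, fun T => ?_⟩
  · exact mul_nonneg (prod_nonneg fun _ _ => hp0) (prod_nonneg fun _ _ => sub_nonneg.2 hp1)
  · have h := prod_add (fun _ : ι => p) (fun a => if a ∈ T then 0 else 1 - p) univ
    have h1 : ∀ a, p + (if a ∈ T then 0 else 1 - p) = if a ∈ T then p else 1 := by
      intro a; split_ifs <;> ring
    simp only [h1, powerset_univ] at h
    rw [prod_ite_mem, univ_inter, prod_const] at h
    rw [h]
    refine sum_congr rfl fun S _ => ?_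
    rw [mul_assoc]
    congr 1
    split_ifs with hTS
    · rw [mul_one]
      refine prod_congr rfl fun a ha => ?_
      rw [if_neg fun haT => (mem_sdiff.1 ha).2 (hTS haT)]
    · obtain ⟨a, haT, haS⟩ := not_subset.1 hTS
      rw [mul_zero, prod_eq_zero (i := a) (by simp [haS]) (by simp [haT])]

/-- Simultaneous first-moment bound for two nonnegative quantities. -/
theorem exists_le_two_mul_of_weighted_sum_le {Ω : Type*} [Fintype Ω] {w f g : Ω → ℝ} {F G : ℝ}
    (hw : ∀ ω, 0 ≤ w ω) (hw1 : ∑ ω, w ω = 1) (hf : ∀ ω, 0 ≤ f ω) (hg : ∀ ω, 0 ≤ g ω)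
    (hF : 0 < F) (hG : 0 < G) (hfF : ∑ ω, w ω * f ω ≤ F) (hgG : ∑ ω, w ω * g ω ≤ G) :
    ∃ ω, f ω ≤ 2 * F ∧ g ω ≤ 2 * G := by
  by_contra! h
  have strict : ∀ ω, 2 * F * G < f ω * G + g ω * F := by
    intro ω
    by_cases hω : f ω ≤ 2 * F
    · nlinarith [h ω hω, mul_nonneg (hf ω) hG.le]
    · push Not at hω
      nlinarith [mul_nonneg (hg ω) hF.le]
  have hex : ∃ ω, 0 < w ω := by
    by_contra! hneg
    have : ∑ ω, w ω ≤ 0 := Finset.sum_nonpos fun ω _ => hneg ω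
    linarith
  obtain ⟨ω₀, hω₀⟩ := hex
  have hlt : ∑ ω, w ω * (2 * F * G) < ∑ ω, w ω * (f ω * G + g ω * F) :=
    Finset.sum_lt_sum (fun ω _ => mul_le_mul_of_nonneg_left (strict ω).le (hw ω))
      ⟨ω₀, Finset.mem_univ _, mul_lt_mul_of_pos_left (strict ω₀) hω₀⟩
  have e : ∑ ω, w ω * (f ω * G + g ω * F) =
      (∑ ω, w ω * f ω) * G + (∑ ω, w ω * g ω) * F := by
    rw [Finset.sum_mul, Finset.sum_mul, ← Finset.sum_add_distrib]
    exact Finset.sum_congr rfl fun ω _ => by ring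
  rw [e, ← Finset.sum_mul, hw1] at hlt
  nlinarith [mul_le_mul_of_nonneg_right hfF hG.le, mul_le_mul_of_nonneg_right hgG hF.le]

/-- The cells `(j, z j)` of a multi-index `z`. -/
def cells {t n : ℕ} (z : Fin t → Fin n) : Finset (Fin t × Fin n) :=
  Finset.univ.image fun j => (j, z j)

theorem cells_subset {t n : ℕ} (z : Fin t → Fin n) (S : Finset (Fin t × Fin n)) :
    cells z ⊆ S ↔ ∀ j, (j, z j) ∈ S := by
  simp [cells, Finset.image_subset_iff]

open Finset in
theorem card_cells {t n : ℕ} (z : Fin t → Fin n) : #(cells z) = t := by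
  rw [cells, card_image_of_injective _ fun i j h => (Prod.ext_iff.1 h).1]
  simp

open Finset in
theorem card_cells_union {t n : ℕ} (z z' : Fin t → Fin n) :
    #(cells z ∪ cells z') + #{j | z j = z' j} = 2 * t := by
  have h : cells z ∩ cells z' = image (fun j => (j, z j)) {j | z j = z' j} := by
    ext ⟨j, i⟩
    simp only [cells, mem_inter, mem_image, mem_univ, true_and, Prod.mk.injEq,
      exists_eq_left, mem_filter]
    grind
  have h' := card_union_add_card_inter (cells z) (cells z')
  rw [h, card_image_of_injective _ fun i j h => (Prod.ext_iff.1 h).1, card_cells,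
    card_cells] at h'
  omega

open Finset in
/-- Second moment of the error made by a rescaled random restriction of a multilinear form. -/
theorem weighted_sum_sq_le {t n : ℕ} {p δ : ℝ} (hp0 : 0 < p) (hp1 : p ≤ 1)
    {w : Finset (Fin t × Fin n) → ℝ}
    (hw : ∀ T : Finset (Fin t × Fin n), ∑ S, w S * (if T ⊆ S then 1 else 0) = p ^ #T)
    (a : (Fin t → Fin n) → ℝ)
    (hplane : ∀ j i, (∑ z : Fin t → Fin n, if z j = i then |a z| else 0) ≤ 1)
    (hsum : ∑ z, |a z| ≤ δ) :
    ∑ S, w S * (∑ z, a z * ((p ^ t)⁻¹ * (if cells z ⊆ S then 1 else 0) - 1)) ^ 2 ≤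
      t * (p ^ t)⁻¹ * δ := by
  have hcov : ∀ z z' : Fin t → Fin n,
      ∑ S, w S * (((p ^ t)⁻¹ * (if cells z ⊆ S then 1 else 0) - 1) *
        ((p ^ t)⁻¹ * (if cells z' ⊆ S then 1 else 0) - 1)) =
      (p ^ #{j | z j = z' j})⁻¹ - 1 := by
    intro z z'
    have e : ∀ S, w S * (((p ^ t)⁻¹ * (if cells z ⊆ S then 1 else 0) - 1) *
        ((p ^ t)⁻¹ * (if cells z' ⊆ S then 1 else 0) - 1)) =
        (p ^ t)⁻¹ * (p ^ t)⁻¹ * (w S * (if cells z ∪ cells z' ⊆ S then 1 else 0)) -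
        (p ^ t)⁻¹ * (w S * (if cells z ⊆ S then 1 else 0)) -
        (p ^ t)⁻¹ * (w S * (if cells z' ⊆ S then 1 else 0)) +
        w S * (if ∅ ⊆ S then 1 else 0) := by
      intro S
      simp only [union_subset_iff, empty_subset, if_true]
      by_cases h : cells z ⊆ S <;> by_cases h' : cells z' ⊆ S <;> simp [h, h'] <;> ring
    simp only [e, sum_add_distrib, sum_sub_distrib, ← mul_sum, hw, card_cells, card_empty]
    have h2 : p ^ t * p ^ t = p ^ #(cells z ∪ cells z') * p ^ #{j | z j = z' j} := by
      rw [← pow_add, ← pow_add, card_cells_union, two_mul]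
    have hpt : p ^ t ≠ 0 := by positivity
    rw [inv_mul_cancel₀ hpt, ← mul_inv, h2]
    field_simp
    ring
  have hbound : ∀ z z' : Fin t → Fin n, |(p ^ #{j | z j = z' j})⁻¹ - 1| ≤
      ∑ j, if z' j = z j then (p ^ t)⁻¹ else 0 := by
    intro z z'
    set q := #{j | z j = z' j} with hq
    have h1 : 1 ≤ (p ^ q)⁻¹ := (one_le_inv₀ (by positivity)).2 (pow_le_one₀ hp0.le hp1)
    rw [abs_of_nonneg (sub_nonneg.2 h1)]
    by_cases h0 : ∃ j, z' j = z j
    · obtain ⟨j, hj⟩ := h0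
      have hqt : q ≤ t := by simpa using card_filter_le (univ : Finset (Fin t)) fun j => z j = z' j
      calc (p ^ q)⁻¹ - 1 ≤ (p ^ q)⁻¹ := by linarith
        _ ≤ (p ^ t)⁻¹ := inv_anti₀ (by positivity) (pow_le_pow_of_le_one hp0.le hp1 hqt)
        _ = if z' j = z j then (p ^ t)⁻¹ else 0 := by rw [if_pos hj]
        _ ≤ _ := single_le_sum (f := fun j => if z' j = z j then (p ^ t)⁻¹ else 0)
            (fun i _ => by positivity) (mem_univ j)
    · have hq0 : q = 0 := by
        rw [hq, card_eq_zero, filter_eq_empty_iff]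
        exact fun j _ h => h0 ⟨j, h.symm⟩
      rw [hq0]
      simp only [pow_zero, inv_one, sub_self]
      positivity
  calc _ = ∑ z, ∑ z', a z * a z' * ((p ^ #{j | z j = z' j})⁻¹ - 1) := by
        simp only [← hcov, sq, sum_mul_sum]
        simp only [mul_sum]
        rw [sum_comm]
        refine sum_congr rfl fun z _ => ?_
        rw [sum_comm]
        exact sum_congr rfl fun z' _ => sum_congr rfl fun S _ => by ring
    _ ≤ ∑ z, ∑ z', |a z| * |a z'| * ∑ j, if z' j = z j then (p ^ t)⁻¹ else 0 := by
        refine sum_le_sum fun z _ => sum_le_sum fun z' _ => (le_abs_self _).trans ?_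
        rw [abs_mul, abs_mul]
        exact mul_le_mul_of_nonneg_left (hbound z z') (by positivity)
    _ = (p ^ t)⁻¹ * ∑ z, |a z| * ∑ j, ∑ z', if z' j = z j then |a z'| else 0 := by
        simp only [mul_sum]
        refine sum_congr rfl fun z _ => ?_
        rw [sum_comm]
        refine sum_congr rfl fun j _ => sum_congr rfl fun z' _ => ?_
        split_ifs <;> ring
    _ ≤ (p ^ t)⁻¹ * ∑ z, |a z| * ∑ _j : Fin t, 1 := by
        gcongr
        exact hplane _ _
    _ = t * (p ^ t)⁻¹ * ∑ z, |a z| := by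
        rw [← sum_mul]
        simp
        ring
    _ ≤ _ := by gcongr

/-- Internal net from an external one, at the cost of a factor `4` in squared distance. -/
theorem exists_internal_net {k : ℕ} {F : Type*} [Fintype F] (L : Set (Fin k → ℝ))
    (c : F → Fin k → ℝ) {R : ℝ} (h : ∀ l ∈ L, ∃ f, ∑ i, (l i - c f i) ^ 2 ≤ R) :
    ∃ N ⊆ L, N.Finite ∧ N.ncard ≤ Fintype.card F ∧
      ∀ l ∈ L, ∃ m ∈ N, ∑ i, (l i - m i) ^ 2 ≤ 4 * R := by
  classical
  let P : Set F := {f | ∃ l ∈ L, ∑ i, (l i - c f i) ^ 2 ≤ R}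
  choose φ hφL hφ using fun f : P => f.2
  refine ⟨Set.range φ, ?_, Set.finite_range φ, ?_, fun l hl => ?_⟩
  · rintro _ ⟨f, rfl⟩
    exact hφL f
  · rw [← Set.image_univ]
    refine (Set.ncard_image_le Set.finite_univ).trans ?_
    rw [Set.ncard_univ, Nat.card_eq_fintype_card]
    exact Fintype.card_subtype_le _
  · obtain ⟨f, hf⟩ := h l hl
    refine ⟨_, ⟨⟨f, l, hl, hf⟩, rfl⟩, ?_⟩
    have h' := hφ ⟨f, l, hl, hf⟩
    calc _ ≤ ∑ i, (2 * (l i - c f i) ^ 2 + 2 * (φ ⟨f, l, hl, hf⟩ i - c f i) ^ 2) :=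
          Finset.sum_le_sum fun i _ => by
            nlinarith [sq_nonneg ((l i - c f i) + (φ ⟨f, l, hl, hf⟩ i - c f i))]
      _ ≤ 4 * R := by
          rw [Finset.sum_add_distrib, ← Finset.mul_sum, ← Finset.mul_sum]
          linarith

/-- Every finset of cardinality at most `m` is listed by a partial `m`-tuple. -/
theorem exists_option_enumeration {κ : Type*} (Q : Finset κ) {m : ℕ} (hQ : Q.card ≤ m) :
    ∃ f : Fin m → Option κ, ∀ q, q ∈ Q ↔ ∃ i, f i = some q := by
  refine ⟨fun i => Q.toList[(i : ℕ)]?, fun q => ?_⟩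
  rw [← Finset.mem_toList, List.mem_iff_getElem?]
  constructor
  · rintro ⟨i, hi⟩
    obtain ⟨hlt, -⟩ := List.getElem?_eq_some_iff.1 hi
    rw [Finset.length_toList] at hlt
    exact ⟨⟨i, hlt.trans_le hQ⟩, hi⟩
  · rintro ⟨i, hi⟩
    exact ⟨i, hi⟩

theorem evalForm_restrict {t n : ℕ} (A : (Fin t → Fin n) → ℝ) (x : Fin t → Fin n → ℝ) (p : ℝ)
    (S : Finset (Fin t × Fin n)) :
    evalForm A (fun j i => if (j, i) ∈ S then p⁻¹ * x j i else 0) =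
      ∑ z, A z * (∏ j, x j (z j)) * ((p ^ t)⁻¹ * (if cells z ⊆ S then 1 else 0)) := by
  refine Finset.sum_congr rfl fun z _ => ?_
  rw [Finset.prod_ite_zero]
  simp only [cells_subset, Finset.mem_univ, true_implies]
  split_ifs
  · rw [Finset.prod_mul_distrib]
    simp
    ring
  · simp

theorem Cball.abs_le_one {n d : ℕ} {x : Fin n → ℝ} (hx : x ∈ Cball n d) (i : Fin n) :
    |x i| ≤ 1 := by
  rcases hx.1 i with h | h | h <;> simp [h]

open Finset in
theorem Cball.card_support {n d : ℕ} {x : Fin n → ℝ} (hx : x ∈ Cball n d) (hd : d ≤ n) :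
    #{i | x i ≠ 0} = d := by
  have h := hx.2
  rw [min_eq_left hd] at h
  rw [← h, ← Set.ncard_coe_finset]
  simp

theorem Cball.sum_abs {n d : ℕ} {x : Fin n → ℝ} (hx : x ∈ Cball n d) (hd : d ≤ n) :
    ∑ i, |x i| = d := by
  have h : ∀ i, |x i| = if x i ≠ 0 then 1 else 0 := by
    intro i
    rcases hx.1 i with h | h | h <;> simp [h]
  simp only [h, Finset.sum_boole]
  exact_mod_cast Cball.card_support hx hd

theorem abs_mul_prod_le {t n : ℕ} {d : Fin t → ℕ} {x : Fin t → Fin n → ℝ}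
    (hx : ∀ s, x s ∈ Cball n (d s)) (A : (Fin t → Fin n) → ℝ) (z : Fin t → Fin n) (j : Fin t) :
    |A z * ∏ s, x s (z s)| ≤ |A z| * |x j (z j)| := by
  rw [abs_mul, Finset.abs_prod, ← Finset.mul_prod_erase _ _ (Finset.mem_univ j)]
  gcongr
  exact mul_le_of_le_one_right (abs_nonneg _)
    (Finset.prod_le_one (fun _ _ => abs_nonneg _) fun s _ => Cball.abs_le_one (hx s) _)

theorem sum_abs_mul_prod_le {t n : ℕ} {d : Fin t → ℕ} {x : Fin t → Fin n → ℝ}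
    (hx : ∀ s, x s ∈ Cball n (d s)) {A : (Fin t → Fin n) → ℝ} (hA : A ∈ PiSet t n) (j : Fin t)
    (hd : d j ≤ n) : ∑ z, |A z * ∏ s, x s (z s)| ≤ d j := by
  calc _ ≤ ∑ z, |A z| * |x j (z j)| := Finset.sum_le_sum fun z _ => abs_mul_prod_le hx A z j
    _ = ∑ i, |x j i| * ∑ z : Fin t → Fin n, if z j = i then |A z| else 0 := by
        simp only [Finset.mul_sum]
        rw [Finset.sum_comm]
        refine Finset.sum_congr rfl fun z _ => ?_
        simp [mul_comm]
    _ ≤ ∑ i, |x j i| * 1 := by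
        gcongr
        exact hA.2 _ _
    _ = d j := by simp only [mul_one]; exact Cball.sum_abs (hx j) hd

open Finset in
/-- A sparse rescaled restriction of `x` on which all the forms are close to their values at `x`. -/
theorem exists_sparse_restriction {t n k : ℕ} {A : Fin k → (Fin t → Fin n) → ℝ}
    (hA : ∀ i, A i ∈ PiSet t n) {d : Fin t → ℕ} {x : Fin t → Fin n → ℝ}
    (hx : ∀ s, x s ∈ Cball n (d s)) (hd : ∀ s, d s ≤ n) {p : ℝ} (hp0 : 0 < p) (hp1 : p ≤ 1)
    {D δ : ℕ} (hD : ∀ s, d s ≤ D) (hδ : ∃ s, d s = δ) (hD0 : 0 < D) (hδ0 : 0 < δ) (hk : 0 < k) :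
    ∃ S : Finset (Fin t × Fin n),
      (#{a ∈ S | x a.1 a.2 ≠ 0} : ℝ) ≤ 2 * (p * (t * D)) ∧
      ∑ i, (evalForm (A i) x -
        evalForm (A i) fun j i => if (j, i) ∈ S then p⁻¹ * x j i else 0) ^ 2 ≤
        2 * (k * (t * (p ^ t)⁻¹ * δ)) := by
  obtain ⟨w, hw0, hw⟩ := exists_bernoulli_weights (ι := Fin t × Fin n) hp0.le hp1
  obtain ⟨s, hs⟩ := hδ
  have ht : (0 : ℝ) < t := by exact_mod_cast s.pos
  have hk' : (0 : ℝ) < k := by exact_mod_cast hk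
  have hD' : (0 : ℝ) < D := by exact_mod_cast hD0
  have hδ' : (0 : ℝ) < δ := by exact_mod_cast hδ0
  refine exists_le_two_mul_of_weighted_sum_le hw0 (by simpa using hw ∅)
    (fun S => by positivity) (fun S => by positivity) (by positivity) (by positivity) ?_ ?_
  · have e : ∀ S : Finset (Fin t × Fin n), w S * (#{a ∈ S | x a.1 a.2 ≠ 0} : ℝ) =
        ∑ a with x a.1 a.2 ≠ 0, w S * (if {a} ⊆ S then 1 else 0) := by
      intro S
      rw [← mul_sum]
      simp only [singleton_subset_iff, sum_boole]
      congr 3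
      ext a
      simp [and_comm]
    simp only [e]
    rw [sum_comm]
    simp only [hw, card_singleton, pow_one, sum_const, nsmul_eq_mul]
    rw [mul_comm]
    gcongr
    have hcard : #{a : Fin t × Fin n | x a.1 a.2 ≠ 0} = ∑ j, d j := by
      rw [card_filter, Fintype.sum_prod_type]
      refine sum_congr rfl fun j _ => ?_
      rw [← card_filter]
      exact Cball.card_support (hx j) (hd j)
    rw [hcard]
    have : ∑ j, d j ≤ t * D := by simpa using sum_le_sum fun j (_ : j ∈ univ) => hD j
    exact_mod_cast this
  · simp only [mul_sum]
    rw [sum_comm]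
    have hone : ∀ i, ∑ S, w S * (evalForm (A i) x -
        evalForm (A i) fun j i => if (j, i) ∈ S then p⁻¹ * x j i else 0) ^ 2 ≤
        t * (p ^ t)⁻¹ * δ := by
      intro i
      have h := weighted_sum_sq_le hp0 hp1 hw (fun z => A i z * ∏ s, x s (z s)) (δ := δ)
        (fun j l => ?_) (hs ▸ sum_abs_mul_prod_le hx (hA i) s (hd s))
      · refine le_of_eq_of_le (sum_congr rfl fun S _ => ?_) h
        rw [evalForm_restrict, evalForm, ← neg_sq, neg_sub, ← sum_sub_distrib]
        simp only [mul_sub, mul_one]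
      · refine le_trans (sum_le_sum fun z _ => ?_) ((hA i).2 j l)
        split_ifs
        · exact (abs_mul_prod_le hx (A i) z j).trans
            (mul_le_of_le_one_right (abs_nonneg _) (Cball.abs_le_one (hx j) _))
        · exact le_rfl
    calc _ ≤ ∑ _i : Fin k, (t * (p ^ t)⁻¹ * δ : ℝ) := sum_le_sum fun i _ => hone i
      _ = _ := by simp

open Classical in
/-- The vectors with entries in `{-p⁻¹, 0, p⁻¹}` described by a partial tuple of signed cells. -/
noncomputable def decodeVector {t n m : ℕ} (p : ℝ)
    (f : Fin m → Option ((Fin t × Fin n) × Bool)) (j : Fin t) (i : Fin n) : ℝ :=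
  if ∃ l, f l = some ((j, i), true) then p⁻¹
  else if ∃ l, f l = some ((j, i), false) then -p⁻¹ else 0

open Finset in
theorem exists_decodeVector_eq {t n m : ℕ} {d : Fin t → ℕ} {x : Fin t → Fin n → ℝ}
    (hx : ∀ s, x s ∈ Cball n (d s)) (p : ℝ) (S : Finset (Fin t × Fin n))
    (hS : #{a ∈ S | x a.1 a.2 ≠ 0} ≤ m) :
    ∃ f : Fin m → Option ((Fin t × Fin n) × Bool),
      decodeVector p f = fun j i => if (j, i) ∈ S then p⁻¹ * x j i else 0 := by
  classical
  obtain ⟨f, hf⟩ := exists_option_enumeration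
    (image (fun a => (a, decide (x a.1 a.2 = 1))) {a ∈ S | x a.1 a.2 ≠ 0}) (card_image_le.trans hS)
  refine ⟨f, ?_⟩
  ext j i
  simp only [decodeVector, ← hf, mem_image, mem_filter, Prod.mk.injEq]
  by_cases hji : (j, i) ∈ S
  · rcases (hx j).1 i with h | h | h
    · have h1 : ¬ ((-1 : ℝ) = 1) := by norm_num
      simp [hji, h, h1]
    · simp [h]
    · simp [hji, h]
  · simp [hji]

theorem natCast_pow_le_rpow {t n m : ℕ} (ht : 3 ≤ t) (hn : 2 ≤ n) {M : ℝ} (hm : (m : ℝ) ≤ M) :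
    (((t * n * 2 + 1) ^ m : ℕ) : ℝ) ≤ (n : ℝ) ^ ((t + 1 : ℝ) * M) := by
  have h2 : 2 * t + 1 ≤ 2 ^ t := by
    induction t, ht using Nat.le_induction with
    | base => norm_num
    | succ t ht ih => rw [pow_succ]; omega
  have hbase : t * n * 2 + 1 ≤ n ^ (t + 1) := by
    calc t * n * 2 + 1 ≤ (2 * t + 1) * n := by nlinarith
      _ ≤ 2 ^ t * n := by gcongr
      _ ≤ n ^ t * n := by gcongr
      _ = n ^ (t + 1) := (pow_succ n t).symm
  have hn1 : (1 : ℝ) ≤ n := by exact_mod_cast (by omega : 1 ≤ n)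
  calc (((t * n * 2 + 1) ^ m : ℕ) : ℝ) ≤ (((n ^ (t + 1)) ^ m : ℕ) : ℝ) := by
        exact_mod_cast Nat.pow_le_pow_left hbase m
    _ = (n : ℝ) ^ ((t + 1 : ℝ) * m) := by
        rw [← pow_mul, Nat.cast_pow, ← Real.rpow_natCast]
        push_cast
        rfl
    _ ≤ _ := Real.rpow_le_rpow_of_exponent_le hn1 (by gcongr)

/-- ε-nets for `Λ_d`: for every `t ≥ 3` there is `C(t) > 0` such that for
all `n ≥ 2`, `k ≥ 1`, `A₁,…,A_k ∈ Π_n^{(t)}`, `d ∈ [n]^t` and every real `ε ≥ 1`, there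
is `N ⊆ Λ_d` with `|N| ≤ n^{2t·max(d)/ε^{2/t}}` such that every point of `Λ_d` is within
Euclidean distance `C(t)·ε·√(k·min(d))` of some point of `N`. -/
theorem stmt18 (t : ℕ) (ht : 3 ≤ t) :
    ∃ C : ℝ, 0 < C ∧
      ∀ (n k : ℕ), 2 ≤ n → 1 ≤ k →
      ∀ A : Fin k → ((Fin t → Fin n) → ℝ), (∀ i, A i ∈ PiSet t n) →
      ∀ d : Fin t → ℕ, (∀ s, d s ∈ Finset.Icc 1 n) →
      ∀ ε : ℝ, 1 ≤ ε →
        ∃ N : Set (Fin k → ℝ), N ⊆ Lambda t n k A d ∧ N.Finite ∧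
          (N.ncard : ℝ) ≤
            (n : ℝ) ^ (2 * (t : ℝ) * ((sSup (Set.range d) : ℕ) : ℝ) / ε ^ ((2:ℝ)/(t:ℝ))) ∧
          ∀ l ∈ Lambda t n k A d, ∃ m ∈ N,
            Real.sqrt (∑ i, (l i - m i) ^ 2) ≤
              C * ε * Real.sqrt ((k : ℝ) * ((sInf (Set.range d) : ℕ) : ℝ)) := by
  have ht0 : (0 : ℝ) < t := by exact_mod_cast (by omega : 0 < t)
  set K : ℝ := 8 * t * (t + 1) ^ t with hK
  have hK0 : 0 < K := by positivity
  refine ⟨√K, Real.sqrt_pos.2 hK0, ?_⟩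
  intro n k hn hk A hA d hd ε hε
  have hε0 : 0 < ε := by linarith
  set D := sSup (Set.range d) with hDdef
  set δ := sInf (Set.range d) with hδdef
  have hd1 : ∀ s, 1 ≤ d s := fun s => (Finset.mem_Icc.1 (hd s)).1
  have hdn : ∀ s, d s ≤ n := fun s => (Finset.mem_Icc.1 (hd s)).2
  have hD : ∀ s, d s ≤ D := fun s => le_csSup (Set.finite_range d).bddAbove ⟨s, rfl⟩
  have hδ : ∃ s, d s = δ := Nat.sInf_mem ⟨d ⟨0, by omega⟩, Set.mem_range_self _⟩
  have hD0 : 0 < D := (hd1 ⟨0, by omega⟩).trans (hD ⟨0, by omega⟩)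
  have hδ0 : 0 < δ := by
    obtain ⟨s, hs⟩ := hδ
    exact hs ▸ hd1 s
  set q : ℝ := ε ^ ((2 : ℝ) / t) with hq
  have hq1 : 1 ≤ q := Real.one_le_rpow hε (by positivity)
  have hq0 : 0 < q := by linarith
  have hqt : q ^ t = ε ^ 2 := by
    rw [hq, ← Real.rpow_mul_natCast hε0.le, div_mul_cancel₀ _ ht0.ne']
    exact_mod_cast Real.rpow_natCast ε 2
  set p : ℝ := ((t + 1) * q)⁻¹ with hp
  have hp0 : 0 < p := by positivity
  have hp1 : p ≤ 1 := inv_le_one_of_one_le₀ (by nlinarith)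
  have hpt : (p ^ t)⁻¹ = (t + 1) ^ t * ε ^ 2 := by
    rw [hp, inv_pow, inv_inv, mul_pow, hqt]
  have hM0 : 0 ≤ 2 * (p * (t * D)) := by positivity
  obtain ⟨N, hNL, hNfin, hNcard, hN⟩ := exists_internal_net (Lambda t n k A d)
    (fun f : Fin ⌊2 * (p * (t * D))⌋₊ → Option ((Fin t × Fin n) × Bool) =>
      fun i => evalForm (A i) (decodeVector p f))
    (R := 2 * (k * (t * (p ^ t)⁻¹ * δ))) (by
      rintro _ ⟨x, hx, rfl⟩
      obtain ⟨S, hS, hdist⟩ := exists_sparse_restriction hA hx hdn hp0 hp1 hD hδ hD0 hδ0 hk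
      obtain ⟨f, hf⟩ := exists_decodeVector_eq hx p S (Nat.le_floor hS)
      exact ⟨f, by simpa only [hf] using hdist⟩)
  refine ⟨N, hNL, hNfin, ?_, fun l hl => ?_⟩
  · have hcard : N.ncard ≤ (t * n * 2 + 1) ^ ⌊2 * (p * (t * D))⌋₊ := by
      simpa using hNcard
    refine (Nat.cast_le.2 hcard).trans
      ((natCast_pow_le_rpow ht hn (Nat.floor_le hM0)).trans_eq ?_)
    congr 1
    rw [hp]
    field_simp
  · obtain ⟨m, hm, hlm⟩ := hN l hl
    refine ⟨m, hm, ?_⟩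
    calc √(∑ i, (l i - m i) ^ 2) ≤ √(K * ε ^ 2 * (k * δ)) := by
          refine Real.sqrt_le_sqrt (hlm.trans_eq ?_)
          rw [hpt, hK]
          ring
      _ = √K * ε * √(k * δ) := by
          rw [Real.sqrt_mul (by positivity), Real.sqrt_mul hK0.le, Real.sqrt_sq hε0.le]
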